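/- arXiv:2507.16482 — 3 statements merged into one kernel-verified Lean document; each statement's English description precedes it below -/
import Mathlib

section
/- Let a, w, w′, b, b′ ∈ A⁺ and x, x′ ∈ A satisfy: (a, w) controls b and b + x; (a, w′) controls b′ and b′ + x′; the subgroup of A generated by {w, x} equals the subgroup of A generated by {w′, x′}; and b′ − b lies in the subgroup of A generated by {w, x}. Then every one-vertex affine configuration C containing the edges {a, a + w} and {b, b + x} can be transformed, by a finite sequence of slide and swap moves, into the configuration obtained from C by replacing these two edges with {a, a + w′} and {b′, b′ + x′}, leaving all other edges unchanged. -/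
/-- The abelian group `A := ℤ/2ℤ ⊕ ⊕_{i≥1} ℤ`. -/
abbrev A : Type := ZMod 2 × (ℕ →₀ ℤ)

/-- `a ∈ A⁺`. -/
def Apos (a : A) : Prop := ∀ i : ℕ, 0 ≤ a.2 i

/-- The support of an element of `A` (ignoring the `ℤ/2ℤ` component). -/
def suppA (a : A) : Finset ℕ := a.2.support

/-- `(a, w)` controls `b`: `b − a ∈ A⁺` and `supp (b − a) ⊆ supp w`. -/
def Controls (a w b : A) : Prop := Apos (b - a) ∧ suppA (b - a) ⊆ suppA w

/-- A one-vertex affine configuration: a finite multiset of unordered pairs of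
points of `A⁺`. -/
def IsConfig (C : Multiset (Sym2 A)) : Prop := ∀ e ∈ C, ∀ p ∈ e, Apos p

/-- A slide move: given two distinct members `{p, q}` and `{r, s}` of `C` with
`s = p + t` for some `t ∈ A⁺`, replace `{r, s}` by `{r, q + t}`. -/
def SlideMove (C C' : Multiset (Sym2 A)) : Prop :=
  ∃ (p q r s' t : A) (rest : Multiset (Sym2 A)),
    Apos t ∧ s' = p + t ∧
    C = s(p, q) ::ₘ s(r, s') ::ₘ rest ∧
    C' = s(p, q) ::ₘ s(r, q + t) ::ₘ rest

/-- A swap move: given two distinct members `{p, p + w₁}` and `{q, q + w₂}` of `C`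
with `w₁, w₂ ∈ A⁺`, `p ≤ q ≤ p + k₁ • w₁` and `p ≤ q ≤ p + k₂ • w₂` for some
`k₁ k₂ : ℕ`, replace them by `{q, q + w₁}` and `{p, p + w₂}`. -/
def SwapMove (C C' : Multiset (Sym2 A)) : Prop :=
  ∃ (p q w₁ w₂ : A) (k₁ k₂ : ℕ) (rest : Multiset (Sym2 A)),
    Apos w₁ ∧ Apos w₂ ∧ Apos (q - p) ∧
    Apos (p + k₁ • w₁ - q) ∧ Apos (p + k₂ • w₂ - q) ∧
    C = s(p, p + w₁) ::ₘ s(q, q + w₂) ::ₘ rest ∧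
    C' = s(q, q + w₁) ::ₘ s(p, p + w₂) ::ₘ rest

/-- A move is a slide move or a swap move. -/
def ConfigMove (C C' : Multiset (Sym2 A)) : Prop := SlideMove C C' ∨ SwapMove C C'

/-- `w` is strictly positive on `S` and vanishes off `S`. -/
def StrictPosOn (S : Finset ℕ) (w : A) : Prop :=
  ∀ i, (i ∈ S → 0 < w.2 i) ∧ (i ∉ S → w.2 i = 0)

/-- `w` is nonnegative on `S` and vanishes off `S`. -/
def NonnegOn (S : Finset ℕ) (w : A) : Prop :=
  ∀ i, (i ∈ S → 0 ≤ w.2 i) ∧ (i ∉ S → w.2 i = 0)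

/-- `x` vanishes off `S`. -/
def SuppIn (S : Finset ℕ) (x : A) : Prop := ∀ i, i ∉ S → x.2 i = 0

/-- The reachability relation generated by slide and swap moves. -/
abbrev Reach : Multiset (Sym2 A) → Multiset (Sym2 A) → Prop := Relation.ReflTransGen ConfigMove

/-- The configuration with edges `{a, a + w}`, `{b, b + x}` and `rest`. -/
noncomputable abbrev pairConfig (a : A) (rest : Multiset (Sym2 A)) (w x b : A) : Multiset (Sym2 A) :=
  s(a, a + w) ::ₘ s(b, b + x) ::ₘ rest

section Positivity

variable {S : Finset ℕ} {u v w x : A}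

lemma StrictPosOn.nonnegOn (h : StrictPosOn S w) : NonnegOn S w :=
  fun i => ⟨fun hi => ((h i).1 hi).le, (h i).2⟩

lemma NonnegOn.suppIn (h : NonnegOn S w) : SuppIn S w := fun i => (h i).2

lemma StrictPosOn.suppIn (h : StrictPosOn S w) : SuppIn S w := h.nonnegOn.suppIn

lemma NonnegOn.apos (h : NonnegOn S w) : Apos w := fun i => by
  by_cases hi : i ∈ S
  · exact (h i).1 hi
  · exact ((h i).2 hi).ge

lemma NonnegOn.add (hu : NonnegOn S u) (hv : NonnegOn S v) : NonnegOn S (u + v) := fun i =>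
  ⟨fun hi => add_nonneg ((hu i).1 hi) ((hv i).1 hi), fun hi => by
    simp [(hu i).2 hi, (hv i).2 hi]⟩

lemma NonnegOn.base_add {a b : A} (hb : NonnegOn S (b - a)) (hv : NonnegOn S v) :
    NonnegOn S (b + v - a) := by
  have := hb.add hv
  rwa [show b - a + v = b + v - a by abel] at this

lemma SuppIn.add (hu : SuppIn S u) (hv : SuppIn S v) : SuppIn S (u + v) := fun i hi => by
  simp [hu i hi, hv i hi]

lemma SuppIn.neg (hu : SuppIn S u) : SuppIn S (-u) := fun i hi => by simp [hu i hi]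

lemma SuppIn.zsmul (hu : SuppIn S u) (n : ℤ) : SuppIn S (n • u) := fun i hi => by
  simp [hu i hi]

lemma SuppIn.sub (hu : SuppIn S u) (hv : SuppIn S v) : SuppIn S (u - v) := by
  rw [sub_eq_add_neg]; exact hu.add hv.neg

lemma SuppIn.exists_strictPosOn_add (hx : SuppIn S x) (hw : StrictPosOn S w) :
    ∃ K : ℕ, StrictPosOn S (x + (K : ℤ) • w) := by
  refine ⟨1 + ∑ i ∈ S, (x.2 i).natAbs, fun i => ⟨fun hi => ?_, fun hi => ?_⟩⟩
  · have h1 := (hw i).1 hi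
    have h2 : (x.2 i).natAbs ≤ ∑ i ∈ S, (x.2 i).natAbs :=
      Finset.single_le_sum (f := fun i => (x.2 i).natAbs) (fun _ _ => Nat.zero_le _) hi
    generalize (∑ i ∈ S, (x.2 i).natAbs) = M at h2 ⊢
    have h3 : -(M : ℤ) ≤ x.2 i := by omega
    simp only [Prod.snd_add, Prod.smul_snd, Finsupp.add_apply, Finsupp.smul_apply, smul_eq_mul]
    push_cast
    nlinarith
  · exact (hx.add (hw.suppIn.zsmul _)) i hi

lemma StrictPosOn.of_zsmul {n : ℤ} (hn : 0 < n) (h : StrictPosOn S (n • x)) : StrictPosOn S x := by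
  intro i
  have hi := h i
  simp only [Prod.smul_snd, Finsupp.smul_apply, smul_eq_mul, mul_eq_zero, hn.ne', false_or] at hi
  exact ⟨fun h => pos_of_mul_pos_right (hi.1 h) hn.le, hi.2⟩

end Positivity

lemma slideMove_symm {C C' : Multiset (Sym2 A)} (h : SlideMove C C') : SlideMove C' C := by
  obtain ⟨p, q, r, s', t, rest, ht, rfl, rfl, rfl⟩ := h
  exact ⟨q, p, r, q + t, t, rest, ht, rfl, by rw [Sym2.eq_swap], by rw [Sym2.eq_swap]⟩

lemma swapMove_symm {C C' : Multiset (Sym2 A)} (h : SwapMove C C') : SwapMove C' C := by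
  obtain ⟨p, q, w₁, w₂, k₁, k₂, rest, h1, h2, h3, h4, h5, rfl, rfl⟩ := h
  exact ⟨p, q, w₂, w₁, k₂, k₁, rest, h2, h1, h3, h5, h4, Multiset.cons_swap _ _ _,
    Multiset.cons_swap _ _ _⟩

lemma Reach.symm {C C' : Multiset (Sym2 A)} (h : Reach C C') : Reach C' C :=
  have : Std.Symm ConfigMove := ⟨fun _ _ h => h.imp slideMove_symm swapMove_symm⟩
  (Relation.ReflTransGen.stdSymm (r := ConfigMove)).symm _ _ h

section Reachability

variable {S : Finset ℕ} {a w x b : A} {rest : Multiset (Sym2 A)}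

lemma reach_slide_nat (hw : NonnegOn S w) (r : A) {y : A} (hy : NonnegOn S (y - a)) (n : ℕ) :
    Reach (s(a, a + w) ::ₘ s(r, y) ::ₘ rest)
      (s(a, a + w) ::ₘ s(r, y + (n : ℤ) • w) ::ₘ rest) := by
  induction n generalizing y with
  | zero => simpa using Relation.ReflTransGen.refl
  | succ n ih =>
    have h1 : ConfigMove (s(a, a + w) ::ₘ s(r, y) ::ₘ rest)
        (s(a, a + w) ::ₘ s(r, y + w) ::ₘ rest) := by
      refine Or.inl ⟨a, a + w, r, y, y - a, rest, hy.apos, by abel, rfl, ?_⟩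
      rw [show a + w + (y - a) = y + w by abel]
    have h2 := ih (hy.base_add hw)
    rw [show y + w + (n : ℤ) • w = y + ((n + 1 : ℕ) : ℤ) • w by push_cast; module] at h2
    exact Relation.ReflTransGen.head h1 h2

lemma reach_slide_right (hw : NonnegOn S w) (r : A) {y : A} (n : ℤ) (hy : NonnegOn S (y - a))
    (hy' : NonnegOn S (y + n • w - a)) :
    Reach (s(a, a + w) ::ₘ s(r, y) ::ₘ rest)
      (s(a, a + w) ::ₘ s(r, y + n • w) ::ₘ rest) := by
  obtain ⟨k, rfl | rfl⟩ := n.eq_nat_or_neg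
  · exact reach_slide_nat hw r hy k
  · have := reach_slide_nat (rest := rest) hw r hy' k
    rw [show y + (-(k : ℤ)) • w + (k : ℤ) • w = y by module] at this
    exact this.symm

lemma reach_slide (hw : NonnegOn S w) (m n : ℤ) (hb : NonnegOn S (b - a))
    (hbx : NonnegOn S (b + x - a)) (hb' : NonnegOn S (b + m • w - a))
    (hbx' : NonnegOn S (b + m • w + (x + n • w) - a)) :
    Reach (pairConfig a rest w x b) (pairConfig a rest w (x + n • w) (b + m • w)) := by
  have e : b + m • w + (x + n • w) = b + x + (m + n) • w := by module
  rw [e] at hbx'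
  have h1 := reach_slide_right (rest := rest) hw b (m + n) hbx hbx'
  have h2 := reach_slide_right (rest := rest) hw (b + x + (m + n) • w) m hb hb'
  unfold pairConfig
  rw [e]
  refine h1.trans ?_
  rw [Sym2.eq_swap (a := b), Sym2.eq_swap (a := b + m • w)]
  exact h2

lemma reach_swap (hw : StrictPosOn S w) (hx : StrictPosOn S x) (hb : NonnegOn S (b - a)) :
    Reach (pairConfig a rest w x b) (pairConfig a rest x w b) := by
  obtain ⟨k₁, h1⟩ := hb.suppIn.neg.exists_strictPosOn_add hw
  obtain ⟨k₂, h2⟩ := hb.suppIn.neg.exists_strictPosOn_add hx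
  refine Relation.ReflTransGen.single (Or.inr ⟨a, b, w, x, k₁, k₂, rest, hw.nonnegOn.apos,
    hx.nonnegOn.apos, hb.apos, ?_, ?_, rfl, Multiset.cons_swap _ _ _⟩)
  · convert h1.nonnegOn.apos using 1
    rw [natCast_zsmul]; abel
  · convert h2.nonnegOn.apos using 1
    rw [natCast_zsmul]; abel

lemma pairConfig_neg : pairConfig a rest w (-x) (b + x) = pairConfig a rest w x b := by
  unfold pairConfig
  rw [add_neg_cancel_right, Sym2.eq_swap (a := b + x)]

lemma reach_translate {b' : A} (hw : StrictPosOn S w) (hx : SuppIn S x)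
    (hb : NonnegOn S (b - a)) (hbx : NonnegOn S (b + x - a)) (hb' : NonnegOn S (b' - a))
    (hbx' : NonnegOn S (b' + x - a)) (h : b' - b ∈ AddSubgroup.closure ({w, x} : Set A)) :
    Reach (pairConfig a rest w x b) (pairConfig a rest w x b') := by
  obtain ⟨m, n, hmn⟩ := AddSubgroup.mem_closure_pair.1 h
  obtain ⟨K, hK⟩ := hx.exists_strictPosOn_add hw
  set X := x + (K : ℤ) • w with hX
  obtain ⟨L, hL⟩ := (hK.suppIn.zsmul n).exists_strictPosOn_add hw
  have hLw : NonnegOn S ((L : ℤ) • w) := fun i =>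
    ⟨fun hi => by
      simpa using mul_nonneg (Int.natCast_nonneg L) ((hw i).1 hi).le, hw.suppIn.zsmul _ i⟩
  have hc := hb.base_add hLw
  have hd : NonnegOn S (b + (L : ℤ) • w + n • X - a) := by
    have := hb.base_add hL.nonnegOn
    rwa [show b + (n • X + (L : ℤ) • w) = b + (L : ℤ) • w + n • X by abel] at this
  have h1 := reach_slide (rest := rest) hw.nonnegOn L K hb hbx hc (hc.base_add hK.nonnegOn)
  have h2 := reach_swap (rest := rest) hw hK hc
  have h3 := reach_slide (rest := rest) hK.nonnegOn n 0 hc (hc.base_add hw.nonnegOn) hd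
    (by simpa using hd.base_add hw.nonnegOn)
  rw [zero_smul, add_zero] at h3
  have h4 := reach_swap (rest := rest) hK hw hd
  have e1 : b + (L : ℤ) • w + n • X + (m - L - n * K) • w = b' := by
    rw [hX, sub_eq_iff_eq_add'.1 hmn.symm]; module
  have e2 : X + (-(K : ℤ)) • w = x := by rw [hX]; module
  have h5 := reach_slide (rest := rest) hw.nonnegOn (m - L - n * K) (-K) hd
    (hd.base_add hK.nonnegOn) (by rwa [e1]) (by rwa [e1, e2])
  rw [e1, e2] at h5
  exact h1.trans (h2.trans (h3.trans (h4.trans h5)))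

end Reachability

/-- The pairs `(w, x)` and `(w', x')` generate the same subgroup and, for all admissible base points
in a common coset, the corresponding configurations are connected by moves. -/
structure Conn (S : Finset ℕ) (a : A) (rest : Multiset (Sym2 A)) (w x w' x' : A) : Prop where
  pos : StrictPosOn S w
  supp : SuppIn S x
  pos' : StrictPosOn S w'
  supp' : SuppIn S x'
  closure_eq : AddSubgroup.closure ({w, x} : Set A) = AddSubgroup.closure ({w', x'} : Set A)
  reach : ∀ b b' : A, NonnegOn S (b - a) → NonnegOn S (b + x - a) → NonnegOn S (b' - a) →
    NonnegOn S (b' + x' - a) → b' - b ∈ AddSubgroup.closure ({w, x} : Set A) →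
    Reach (pairConfig a rest w x b) (pairConfig a rest w' x' b')

namespace Conn

variable {S : Finset ℕ} {a w x w' x' w'' x'' : A} {rest : Multiset (Sym2 A)}

lemma refl (hw : StrictPosOn S w) (hx : SuppIn S x) : Conn S a rest w x w x :=
  ⟨hw, hx, hw, hx, rfl, fun _ _ h1 h2 h3 h4 h5 => reach_translate hw hx h1 h2 h3 h4 h5⟩

lemma symm (h : Conn S a rest w x w' x') : Conn S a rest w' x' w x :=
  ⟨h.pos', h.supp', h.pos, h.supp, h.closure_eq.symm, fun b b' h1 h2 h3 h4 h5 =>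
    (h.reach b' b h3 h4 h1 h2 (by
      rw [h.closure_eq, ← neg_sub]; exact neg_mem h5)).symm⟩

lemma trans (h : Conn S a rest w x w' x') (h' : Conn S a rest w' x' w'' x'') :
    Conn S a rest w x w'' x'' := by
  refine ⟨h.pos, h.supp, h'.pos', h'.supp', h.closure_eq.trans h'.closure_eq,
    fun b b' h1 h2 h3 h4 h5 => ?_⟩
  obtain ⟨K, hK⟩ := h.supp'.exists_strictPosOn_add h.pos
  have hKw : NonnegOn S ((K : ℤ) • w) := fun i =>
    ⟨fun hi => by
      simpa using mul_nonneg (Int.natCast_nonneg K) ((h.pos i).1 hi).le, h.pos.suppIn.zsmul _ i⟩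
  have hm : (K : ℤ) • w ∈ AddSubgroup.closure ({w, x} : Set A) :=
    zsmul_mem (AddSubgroup.subset_closure (by simp)) _
  have hc := h1.base_add hKw
  have hd : NonnegOn S (b + (K : ℤ) • w + x' - a) := by
    have := h1.base_add hK.nonnegOn
    rwa [show b + (x' + (K : ℤ) • w) = b + (K : ℤ) • w + x' by abel] at this
  refine (h.reach b (b + (K : ℤ) • w) h1 h2 hc hd (by simpa using hm)).trans
    (h'.reach (b + (K : ℤ) • w) b' hc hd h3 h4 ?_)
  rw [← h.closure_eq, ← sub_sub]
  exact sub_mem h5 hm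

lemma neg (hw : StrictPosOn S w) (hx : SuppIn S x) : Conn S a rest w x w (-x) := by
  have hcl : AddSubgroup.closure ({w, x} : Set A) = AddSubgroup.closure ({w, -x} : Set A) := by
    ext z
    simp only [AddSubgroup.mem_closure_pair]
    exact ⟨fun ⟨m, n, h⟩ => ⟨m, -n, by rw [← h]; module⟩,
      fun ⟨m, n, h⟩ => ⟨m, -n, by rw [← h]; module⟩⟩
  refine ⟨hw, hx, hw, hx.neg, hcl, fun b b' h1 h2 h3 h4 h5 => ?_⟩
  rw [← pairConfig_neg]
  refine reach_translate hw hx.neg h2 (by simpa using h1) h3 h4 ?_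
  rw [← hcl, ← sub_sub]
  exact sub_mem h5 (AddSubgroup.subset_closure (by simp))

lemma shift (hw : StrictPosOn S w) (hx : SuppIn S x) (k : ℤ) :
    Conn S a rest w x w (x + k • w) := by
  have hx' : SuppIn S (x + k • w) := hx.add (hw.suppIn.zsmul k)
  have hcl : AddSubgroup.closure ({w, x} : Set A) =
      AddSubgroup.closure ({w, x + k • w} : Set A) := by
    ext z
    simp only [AddSubgroup.mem_closure_pair]
    exact ⟨fun ⟨m, n, h⟩ => ⟨m - n * k, n, by rw [← h]; module⟩,
      fun ⟨m, n, h⟩ => ⟨m + n * k, n, by rw [← h]; module⟩⟩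
  refine ⟨hw, hx, hw, hx', hcl, fun b b' h1 h2 h3 h4 h5 => ?_⟩
  obtain ⟨K, hK⟩ := hx'.exists_strictPosOn_add hw
  have hKw : NonnegOn S ((K : ℤ) • w) := fun i =>
    ⟨fun hi => by
      simpa using mul_nonneg (Int.natCast_nonneg K) ((hw i).1 hi).le, hw.suppIn.zsmul _ i⟩
  have hc := h1.base_add hKw
  have hd : NonnegOn S (b + (K : ℤ) • w + (x + k • w) - a) := by
    have := h1.base_add hK.nonnegOn
    rwa [show b + (x + k • w + (K : ℤ) • w) = b + (K : ℤ) • w + (x + k • w) by abel] at this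
  refine (reach_slide hw.nonnegOn K k h1 h2 hc hd).trans
    (reach_translate hw hx' hc hd h3 h4 ?_)
  rw [← hcl, ← sub_sub]
  exact sub_mem h5 (zsmul_mem (AddSubgroup.subset_closure (by simp)) _)

lemma swap (hw : StrictPosOn S w) (hx : StrictPosOn S x) : Conn S a rest w x x w := by
  have hcl : AddSubgroup.closure ({w, x} : Set A) = AddSubgroup.closure ({x, w} : Set A) := by
    rw [Set.pair_comm]
  refine ⟨hw, hx.suppIn, hx, hw.suppIn, hcl, fun b b' h1 _ h3 h4 h5 => ?_⟩
  exact (reach_swap hw hx h1).trans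
    (reach_translate hx hw.suppIn h1 (h1.base_add hw.nonnegOn) h3 h4 (hcl ▸ h5))

/-- The Euclidean algorithm on the coefficients of a nonnegative `u` in `⟨w, x⟩`. -/
lemma exists_coeff_eq_zero {u : A} (hu : NonnegOn S u) (hw : StrictPosOn S w) (hx : SuppIn S x)
    (α β : ℤ) (h : u = α • w + β • x) :
    ∃ w₁ x₁ : A, ∃ α₁ β₁ : ℤ, Conn S a rest w x w₁ x₁ ∧ u = α₁ • w₁ + β₁ • x₁ ∧
      (α₁ = 0 ∨ β₁ = 0) ∧ (α ≠ 0 ∨ β ≠ 0 → α₁ ≠ 0 ∨ β₁ ≠ 0) := by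
  induction hn : β.natAbs using Nat.strong_induction_on generalizing w x α β with
  | _ n ih =>
  subst hn
  by_cases hβ : β = 0
  · exact ⟨w, x, α, β, refl hw hx, h, Or.inr hβ, id⟩
  obtain ⟨y, β', hβ', hlt, hy, hconn, hu'⟩ : ∃ y : A, ∃ β' : ℤ, 0 < β' ∧ β' = β.natAbs ∧
      SuppIn S y ∧ Conn S a rest w x w y ∧ u = α • w + β' • y := by
    rcases lt_or_gt_of_ne hβ with h0 | h0
    · exact ⟨-x, -β, by omega, by omega, hx.neg, neg hw hx, by rw [h]; module⟩
    · exact ⟨x, β, h0, by omega, hx, refl hw hx, h⟩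
  have hdiv := Int.mul_ediv_add_emod (-α) β'
  have hmod := Int.emod_nonneg (-α) hβ'.ne'
  have hmod' := Int.emod_lt_of_pos (-α) hβ'
  set q := (-α) / β'
  set r := (-α) % β'
  have hα : α = -(β' * q) - r := by omega
  have hconn' := hconn.trans (shift hw hy (-q))
  set z := y + (-q) • w with hz
  have huz : u = (-r) • w + β' • z := by rw [hu', hz, hα]; module
  by_cases hr : r = 0
  · exact ⟨w, z, -r, β', hconn', huz, Or.inl (by omega), fun _ => Or.inr hβ'.ne'⟩
  have hzpos : StrictPosOn S z := by
    refine StrictPosOn.of_zsmul hβ' fun i => ⟨fun hi => ?_, hconn'.supp'.zsmul _ i⟩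
    have e : β' • z = u + r • w := by rw [huz]; module
    rw [e]
    have := mul_pos (show 0 < r by omega) ((hw i).1 hi)
    have := (hu i).1 hi
    simp only [Prod.snd_add, Prod.smul_snd, Finsupp.add_apply, Finsupp.smul_apply, smul_eq_mul]
    omega
  obtain ⟨w₁, x₁, α₁, β₁, h1, h2, h3, h4⟩ := ih (-r).natAbs (by omega) hzpos hw.suppIn β' (-r)
    (by rw [huz]; abel) rfl
  exact ⟨w₁, x₁, α₁, β₁, (hconn'.trans (swap hw hzpos)).trans h1, h2, h3,
    fun _ => h4 (Or.inl hβ'.ne')⟩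

/-- If `u` is strictly positive in `⟨w, x⟩`, one can reach a pair whose first entry divides `u`. -/
lemma exists_eq_zsmul {u : A} (hu : StrictPosOn S u) (hu0 : u ≠ 0) (hw : StrictPosOn S w)
    (hx : SuppIn S x) (h : u ∈ AddSubgroup.closure ({w, x} : Set A)) :
    ∃ w₁ x₁ : A, ∃ α : ℤ, Conn S a rest w x w₁ x₁ ∧ u = α • w₁ := by
  obtain ⟨α, β, hαβ⟩ := AddSubgroup.mem_closure_pair.1 h
  obtain ⟨w₁, x₁, α₁, β₁, h1, h2, h3, -⟩ :=
    exists_coeff_eq_zero (a := a) (rest := rest) hu.nonnegOn hw hx α β hαβ.symm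
  rcases h3 with rfl | rfl
  · rw [zero_smul, zero_add] at h2
    rcases lt_trichotomy β₁ 0 with h0 | rfl | h0
    · have e : u = (-β₁) • (-x₁) := by rw [h2]; module
      have hp : StrictPosOn S (-x₁) := StrictPosOn.of_zsmul (n := -β₁) (by omega) (e ▸ hu)
      exact ⟨-x₁, w₁, -β₁, (h1.trans (neg h1.pos' h1.supp')).trans (swap h1.pos' hp), e⟩
    · simp [hu0] at h2
    · have hp : StrictPosOn S x₁ := StrictPosOn.of_zsmul h0 (h2 ▸ hu)
      exact ⟨x₁, w₁, β₁, h1.trans (swap h1.pos' hp), h2⟩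
  · exact ⟨w₁, x₁, α₁, h1, by simpa using h2⟩

lemma of_independent (hw : StrictPosOn S w) (hx : SuppIn S x) (hw' : StrictPosOn S w')
    (hcl : AddSubgroup.closure ({w, x} : Set A) = AddSubgroup.closure ({w', x'} : Set A))
    (hind : ∀ m n : ℤ, m • w' + n • x' = 0 → m = 0 ∧ n = 0) : Conn S a rest w x w' x' := by
  have hw'0 : w' ≠ 0 := fun h => by simpa using (hind 1 0 (by simp [h])).1
  obtain ⟨w₁, x₁, α, h1, h2⟩ := exists_eq_zsmul (a := a) (rest := rest) hw' hw'0 hw hx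
    (hcl ▸ AddSubgroup.subset_closure (by simp))
  refine h1.trans ?_
  have hcl' := h1.closure_eq.symm.trans hcl
  obtain ⟨p, q, hpq⟩ := AddSubgroup.mem_closure_pair.1
    (show w₁ ∈ AddSubgroup.closure ({w', x'} : Set A) from
      hcl' ▸ AddSubgroup.subset_closure (by simp))
  obtain ⟨r, s, hrs⟩ := AddSubgroup.mem_closure_pair.1
    (show x₁ ∈ AddSubgroup.closure ({w', x'} : Set A) from
      hcl' ▸ AddSubgroup.subset_closure (by simp))
  obtain ⟨γ, δ, hγδ⟩ := AddSubgroup.mem_closure_pair.1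
    (show x' ∈ AddSubgroup.closure ({w₁, x₁} : Set A) from
      hcl' ▸ AddSubgroup.subset_closure (by simp))
  obtain ⟨hp, hq⟩ := hind (α * p - 1) (α * q) (by
    have : α • (p • w' + q • x') - w' = 0 := by rw [hpq, ← h2, sub_self]
    rw [← this]; module)
  have hαp : α * p = 1 := by omega
  have hα0 : α ≠ 0 := by rintro rfl; simp at hαp
  obtain rfl : q = 0 := by simpa [hα0] using hq
  have hα : α = 1 := by
    rcases Int.eq_one_or_neg_one_of_mul_eq_one hαp with h | h
    · exact h
    exfalso
    have hz : w'.2 = 0 := by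
      ext i
      by_cases hi : i ∈ S
      · have h3 := (hw' i).1 hi
        have h4 := (h1.pos' i).1 hi
        rw [h2, h] at h3
        simp at h3
        omega
      · exact (hw' i).2 hi
    have h2w : (2 : ℤ) • w' = 0 := by
      refine Prod.ext ?_ (by simp [hz])
      have h2c : ∀ c : ZMod 2, (2 : ℤ) • c = 0 := by decide
      exact h2c w'.1
    simpa using (hind 2 0 (by rw [h2w]; simp)).1
  subst hα
  rw [one_smul] at h2
  subst h2
  obtain ⟨-, hδ⟩ := hind (γ + δ * r) (δ * s - 1) (by
    have : γ • w' + δ • (r • w' + s • x') - x' = 0 := by rw [hrs, hγδ, sub_self]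
    rw [← this]; module)
  have hδs : δ * s = 1 := by omega
  rcases Int.eq_one_or_neg_one_of_mul_eq_one hδs with rfl | rfl
  · have := shift (a := a) (rest := rest) h1.pos' h1.supp' γ
    rwa [show x₁ + γ • w' = x' by rw [← hγδ]; module] at this
  · have := (neg (a := a) (rest := rest) h1.pos' h1.supp').trans
      (shift h1.pos' h1.supp'.neg γ)
    rwa [show -x₁ + γ • w' = x' by rw [← hγδ]; module] at this

lemma exists_torsion (hw : StrictPosOn S w) (hx : SuppIn S x) {m n : ℤ} (hmn : m ≠ 0 ∨ n ≠ 0)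
    (h : m • w + n • x = 0) :
    ∃ w₁ x₁ : A, Conn S a rest w x w₁ x₁ ∧ x₁.2 = 0 := by
  obtain ⟨w₁, x₁, α, β, h1, h2, h3, h4⟩ := exists_coeff_eq_zero (a := a) (rest := rest)
    (u := 0) (fun i => by simp) hw hx m n h.symm
  refine ⟨w₁, x₁, h1, ?_⟩
  have h4 := h4 hmn
  ext i
  rcases h3 with rfl | rfl
  · have := congrArg (fun u : A => u.2 i) h2
    simp at this h4
    simpa [h4] using this
  · have := congrArg (fun u : A => u.2 i) h2
    simp at this h4
    have hwi : w₁.2 i = 0 := by simpa [h4] using this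
    refine h1.supp' i fun hi => ?_
    exact ((h1.pos' i).1 hi).ne' hwi

lemma add_torsion {c d : ZMod 2} {v : ℕ →₀ ℤ} (hw : StrictPosOn S ((c, v) : A)) :
    Conn S a rest (c, v) (1, 0) (d, v) (1, 0) := by
  have ht : SuppIn S ((1, 0) : A) := fun i _ => rfl
  by_cases hcd : d = c
  · subst hcd; exact refl hw ht
  have hd : d = 1 + c := (by decide : ∀ c d : ZMod 2, ¬d = c → d = 1 + c) c d hcd
  have hw' : StrictPosOn S ((d, v) : A) := hw
  have h1 := shift (a := a) (rest := rest) hw ht 1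
  rw [show ((1, 0) : A) + (1 : ℤ) • (c, v) = (d, v) by simp [hd]] at h1
  have h2 := shift (a := a) (rest := rest) hw' hw.suppIn (-1)
  rw [show ((c, v) : A) + (-1 : ℤ) • (d, v) = (1, 0) by
    simp only [hd, neg_smul, one_smul, Prod.neg_mk, Prod.mk_add_mk, add_neg_cancel]
    rw [(by decide : ∀ c : ZMod 2, c + -(1 + c) = 1) c]] at h2
  exact (h1.trans (swap hw hw')).trans h2

lemma torsion_zero_right {c c' : ZMod 2} {v : ℕ →₀ ℤ} (hw : StrictPosOn S ((c, v) : A))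
    (hcl : AddSubgroup.closure ({(c, v), (1, 0)} : Set A) =
      AddSubgroup.closure ({(c', v), (0, 0)} : Set A)) :
    Conn S a rest (c, v) (1, 0) (c', v) (0, 0) := by
  obtain ⟨k, l, hkl⟩ := AddSubgroup.mem_closure_pair.1
    (show ((1, 0) : A) ∈ AddSubgroup.closure ({(c', v), (0, 0)} : Set A) from
      hcl ▸ AddSubgroup.subset_closure (by simp))
  simp only [Prod.smul_mk, Prod.mk_add_mk, smul_zero, add_zero, Prod.mk.injEq] at hkl
  obtain ⟨hk1, hk2⟩ := hkl
  have hc' : c' = 1 := by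
    by_contra hne
    have : c' = 0 := (by decide : ∀ c : ZMod 2, ¬c = 1 → c = 0) c' hne
    rw [this] at hk1
    simp at hk1
  have hk : k ≠ 0 := by rintro rfl; simp at hk1
  obtain rfl : v = 0 := by simpa [hk] using hk2
  subst hc'
  refine (add_torsion (d := 1) hw).trans ?_
  have := shift (a := a) (rest := rest) (S := S) (w := (1, 0)) (x := (1, 0)) hw
    (fun i _ => rfl) (-1)
  rwa [show ((1, 0) : A) + (-1 : ℤ) • (1, 0) = (0, 0) by
    rw [neg_one_zsmul, add_neg_cancel]; rfl] at this

lemma of_torsion (hw : StrictPosOn S w) (hw' : StrictPosOn S w')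
    (hcl : AddSubgroup.closure ({w, x} : Set A) = AddSubgroup.closure ({w', x'} : Set A))
    (hx2 : x.2 = 0) (hx'2 : x'.2 = 0) : Conn S a rest w x w' x' := by
  obtain ⟨c, v⟩ := w
  obtain ⟨c', v'⟩ := w'
  obtain ⟨d, y⟩ := x
  obtain ⟨d', y'⟩ := x'
  obtain rfl : y = 0 := hx2
  obtain rfl : y' = 0 := hx'2
  obtain ⟨k, l, hkl⟩ := AddSubgroup.mem_closure_pair.1
    (show ((c', v') : A) ∈ AddSubgroup.closure ({(c, v), (d, 0)} : Set A) from
      hcl ▸ AddSubgroup.subset_closure (by simp))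
  obtain ⟨k', l', hkl'⟩ := AddSubgroup.mem_closure_pair.1
    (show ((c, v) : A) ∈ AddSubgroup.closure ({(c', v'), (d', 0)} : Set A) from
      hcl ▸ AddSubgroup.subset_closure (by simp))
  simp only [Prod.smul_mk, Prod.mk_add_mk, smul_zero, add_zero, Prod.mk.injEq] at hkl hkl'
  obtain ⟨hk1, hk2⟩ := hkl
  obtain ⟨hk1', hk2'⟩ := hkl'
  obtain rfl : v = v' := by
    ext i
    refine Int.dvd_antisymm (hw.nonnegOn.apos i) (hw'.nonnegOn.apos i) ⟨k, ?_⟩ ⟨k', ?_⟩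
    · rw [← hk2]; simp [mul_comm]
    · rw [← hk2']; simp [mul_comm]
  have h01 : ∀ e : ZMod 2, e = 0 ∨ e = 1 := by decide
  rcases h01 d with rfl | rfl <;> rcases h01 d' with rfl | rfl
  · obtain rfl : c = c' := by
      rcases h01 c with rfl | rfl <;> rcases h01 c' with rfl | rfl
      · rfl
      · simp at hk1
      · simp at hk1'
      · rfl
    exact refl hw fun i _ => rfl
  · exact (torsion_zero_right hw' hcl.symm).symm
  · exact torsion_zero_right hw hcl
  · exact add_torsion hw

lemma of_closure_eq (hw : StrictPosOn S w) (hx : SuppIn S x) (hw' : StrictPosOn S w')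
    (hx' : SuppIn S x')
    (hcl : AddSubgroup.closure ({w, x} : Set A) = AddSubgroup.closure ({w', x'} : Set A)) :
    Conn S a rest w x w' x' := by
  by_cases hi' : ∀ m n : ℤ, m • w' + n • x' = 0 → m = 0 ∧ n = 0
  · exact of_independent hw hx hw' hcl hi'
  by_cases hi : ∀ m n : ℤ, m • w + n • x = 0 → m = 0 ∧ n = 0
  · exact (of_independent hw' hx' hw hcl.symm hi).symm
  simp only [not_forall, not_and_or] at hi hi'
  obtain ⟨m, n, h, hmn⟩ := hi
  obtain ⟨m', n', h', hmn'⟩ := hi'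
  obtain ⟨w₁, x₁, h1, h1x⟩ := exists_torsion (a := a) (rest := rest) hw hx hmn h
  obtain ⟨w₂, x₂, h2, h2x⟩ := exists_torsion (a := a) (rest := rest) hw' hx' hmn' h'
  exact (h1.trans (of_torsion h1.pos' h2.pos'
    (h1.closure_eq.symm.trans (hcl.trans h2.closure_eq)) h1x h2x)).trans h2.symm

end Conn

lemma Controls.nonnegOn {a w b : A} (h : Controls a w b) : NonnegOn (suppA w) (b - a) := fun i =>
  ⟨fun _ => h.1 i, fun hi => Finsupp.notMem_support_iff.1 fun h' => hi (h.2 h')⟩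

lemma Apos.strictPosOn {w : A} (h : Apos w) : StrictPosOn (suppA w) w := fun i =>
  ⟨fun hi => lt_of_le_of_ne (h i) (Finsupp.mem_support_iff.1 hi).symm,
    fun hi => Finsupp.notMem_support_iff.1 hi⟩

lemma Controls.suppIn {a w b x : A} (h1 : Controls a w b) (h2 : Controls a w (b + x)) :
    SuppIn (suppA w) x := by
  have := h2.nonnegOn.suppIn.sub h1.nonnegOn.suppIn
  rwa [show b + x - a - (b - a) = x by abel] at this

lemma suppA_subset_of_mem_closure {w x u : A} (hx : SuppIn (suppA w) x)
    (h : u ∈ AddSubgroup.closure ({w, x} : Set A)) : suppA u ⊆ suppA w := by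
  obtain ⟨m, n, rfl⟩ := AddSubgroup.mem_closure_pair.1 h
  intro i hi
  by_contra hiw
  refine Finsupp.mem_support_iff.1 hi ?_
  have hwi : w.2 i = 0 := Finsupp.notMem_support_iff.1 hiw
  simp [hwi, hx i hiw]

/-- Lemma 5.4: if `(a, w)` controls `b, b + x`, `(a, w')` controls `b', b' + x'`,
`⟨w, x⟩ = ⟨w', x'⟩ ≤ A` and `b' − b ∈ ⟨w, x⟩`, then any configuration containing
the edges `{a, a + w}` and `{b, b + x}` can be transformed by slides and swaps
into the one where these two edges are replaced by `{a, a + w'}` and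
`{b', b' + x'}`, all other edges unchanged. -/
theorem stmt_3 (a w w' b b' : A) (x x' : A)
    (ha : Apos a) (hw : Apos w) (hw' : Apos w') (hb : Apos b) (hb' : Apos b')
    (h1 : Controls a w b) (h2 : Controls a w (b + x))
    (h3 : Controls a w' b') (h4 : Controls a w' (b' + x'))
    (hgen : AddSubgroup.closure ({w, x} : Set A) = AddSubgroup.closure ({w', x'} : Set A))
    (hdiff : b' - b ∈ AddSubgroup.closure ({w, x} : Set A))
    (C : Multiset (Sym2 A)) (hC : IsConfig C) (rest : Multiset (Sym2 A))
    (hCeq : C = s(a, a + w) ::ₘ s(b, b + x) ::ₘ rest) :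
    Relation.ReflTransGen ConfigMove C
      (s(a, a + w') ::ₘ s(b', b' + x') ::ₘ rest) := by
  have hx := h1.suppIn h2
  have hx' := h3.suppIn h4
  have hS : suppA w' = suppA w := by
    refine (suppA_subset_of_mem_closure hx ?_).antisymm (suppA_subset_of_mem_closure hx' ?_)
    · exact hgen ▸ AddSubgroup.subset_closure (by simp)
    · exact hgen ▸ AddSubgroup.subset_closure (by simp)
  have hwpos' := hw'.strictPosOn
  have hb'a := h3.nonnegOn
  have hb'x := h4.nonnegOn
  rw [hS] at hx' hwpos' hb'a hb'x
  rw [hCeq]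
  exact (Conn.of_closure_eq hw.strictPosOn hx hwpos' hx' hgen).reach b b' h1.nonnegOn h2.nonnegOn
    hb'a hb'x hdiff
end

section
/- Let (Γ, ψ) be a GBS graph, v ∈ V, and e ∈ E with ι(e) = τ(e) = v, ψ(ē) = 1 and ψ(e) = n. Let ℓ ∈ Z∖{0} and k ∈ N with ℓ dividing n^k, and let ψ′ agree with ψ except that ψ′(d) = ℓ·ψ(d) for every edge d ∉ {e, ē} with τ(d) = v (an induction move). Then the universal groups F(Γ, ψ) and F(Γ, ψ′) are isomorphic; explicitly, the assignment fixing all generators other than v and sending v ↦ v^ℓ extends to an isomorphism F(Γ, ψ) → F(Γ, ψ′), whose inverse fixes all generators other than v and sends v ↦ e^k·v^{n^k/ℓ}·e^{−k}. -/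
/-- A GBS graph: a finite graph in the sense of Serre (vertex set `V`, edge set
`E`, fixed-point-free involution `bar`, initial-vertex map `ini`), together with
a labelling of the edges by nonzero integers. -/
structure GBSGraph (V E : Type) : Type where
  bar : E → E
  bar_ne : ∀ e, bar e ≠ e
  bar_invol : ∀ e, bar (bar e) = e
  ini : E → V
  label : E → ℤ
  label_ne : ∀ e, label e ≠ 0

namespace GBSGraph

variable {V E : Type}

/-- Terminal vertex of an edge. -/
def ter (G : GBSGraph V E) (e : E) : V := G.ini (G.bar e)

/-- The defining relators of the universal group `F(Γ, ψ)`: for every edge `e`,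
`ē·e = 1` and `ι(e)^{ψ(ē)}·e·(τ(e)^{ψ(e)})⁻¹·e⁻¹ = 1`. -/
def rels (G : GBSGraph V E) : Set (FreeGroup (V ⊕ E)) :=
  (Set.range fun e : E =>
    FreeGroup.of (Sum.inr (G.bar e)) * FreeGroup.of (Sum.inr e)) ∪
  (Set.range fun e : E =>
    FreeGroup.of (Sum.inl (G.ini e)) ^ G.label (G.bar e) * FreeGroup.of (Sum.inr e) *
      (FreeGroup.of (Sum.inl (G.ter e)) ^ G.label e)⁻¹ * (FreeGroup.of (Sum.inr e))⁻¹)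

end GBSGraph

namespace GBSGraph

variable {V E : Type}

theorem ter_bar (G : GBSGraph V E) (f : E) : G.ter (G.bar f) = G.ini f := by
  simp [ter, G.bar_invol]

theorem of_bar (G : GBSGraph V E) (f : E) :
    (PresentedGroup.of (Sum.inr (G.bar f)) : PresentedGroup G.rels) =
      (PresentedGroup.of (Sum.inr f))⁻¹ := by
  refine eq_inv_of_mul_eq_one_left ?_
  exact PresentedGroup.one_of_mem (rels := G.rels) (Or.inl ⟨f, rfl⟩)

theorem of_ini_zpow_mul (G : GBSGraph V E) (f : E) :
    (PresentedGroup.of (Sum.inl (G.ini f)) : PresentedGroup G.rels) ^ G.label (G.bar f) *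
        PresentedGroup.of (Sum.inr f) =
      PresentedGroup.of (Sum.inr f) * PresentedGroup.of (Sum.inl (G.ter f)) ^ G.label f := by
  have h := PresentedGroup.one_of_mem (rels := G.rels) (Or.inr ⟨f, rfl⟩)
  simp only [map_mul, map_zpow, map_inv] at h
  exact mul_inv_eq_iff_eq_mul.mp (mul_inv_eq_one.mp h)

/-- A family in a group satisfying the defining relations of `F(Γ, ψ)` induces a homomorphism. -/
theorem exists_hom {K : Type*} [Group K] (G : GBSGraph V E) (a : V → K) (b : E → K)
    (hb : ∀ f, b (G.bar f) * b f = 1)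
    (hab : ∀ f, a (G.ini f) ^ G.label (G.bar f) * b f = b f * a (G.ter f) ^ G.label f) :
    ∃ φ : PresentedGroup G.rels →* K,
      (∀ u, φ (PresentedGroup.of (Sum.inl u)) = a u) ∧
      ∀ f, φ (PresentedGroup.of (Sum.inr f)) = b f := by
  have h : ∀ r ∈ G.rels, FreeGroup.lift (Sum.elim a b) r = 1 := by
    rintro r (⟨f, rfl⟩ | ⟨f, rfl⟩)
    · simpa using hb f
    · simp [hab f]
  exact ⟨PresentedGroup.toGroup h, fun u => PresentedGroup.toGroup.of h,
    fun f => PresentedGroup.toGroup.of h⟩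

/-- For two labellings of the same graph, a reassignment of the vertex generators that matches the
vertex powers at all edges other than `e` and `ē`, and satisfies the relation of `e`, induces a
homomorphism of universal groups fixing the edge generators. -/
theorem exists_hom_of_zpow_eq (G H : GBSGraph V E) (hbar : H.bar = G.bar) (hini : H.ini = G.ini)
    (e : E) (a : V → PresentedGroup H.rels)
    (hpow : ∀ d, d ≠ e → d ≠ G.bar e →
      a (G.ter d) ^ G.label d = PresentedGroup.of (Sum.inl (G.ter d)) ^ H.label d)
    (he : a (G.ini e) ^ G.label (G.bar e) * PresentedGroup.of (Sum.inr e) =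
      PresentedGroup.of (Sum.inr e) * a (G.ter e) ^ G.label e) :
    ∃ φ : PresentedGroup G.rels →* PresentedGroup H.rels,
      (∀ u, φ (PresentedGroup.of (Sum.inl u)) = a u) ∧
      ∀ f, φ (PresentedGroup.of (Sum.inr f)) = PresentedGroup.of (Sum.inr f) := by
  have hinv (f : E) : (PresentedGroup.of (Sum.inr (G.bar f)) : PresentedGroup H.rels) =
      (PresentedGroup.of (Sum.inr f))⁻¹ := hbar ▸ H.of_bar f
  have hter (f : E) : H.ter f = G.ter f := by simp [ter, hbar, hini]
  refine G.exists_hom a (fun f => PresentedGroup.of (Sum.inr f)) (fun f => by simp [hinv]) ?_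
  intro f
  by_cases h1 : f = e
  · exact h1 ▸ he
  by_cases h2 : f = G.bar e
  · subst h2
    rw [ter_bar, G.bar_invol, hinv]
    change a (G.ter e) ^ _ * _ = _
    rw [mul_inv_eq_iff_eq_mul, mul_assoc, he, inv_mul_cancel_left]
  · have h3 : G.bar f ≠ e := fun h => h2 (by rw [← h, G.bar_invol])
    have h4 : G.bar f ≠ G.bar e := fun h => h1 (by rw [← G.bar_invol f, h, G.bar_invol])
    have h5 := hpow _ h3 h4
    rw [ter_bar] at h5
    have h6 := H.of_ini_zpow_mul f
    rw [hter, hini, hbar] at h6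
    rw [h5, hpow f h1 h2, h6]

end GBSGraph

/-- If `x t = t x ^ n`, then `t ^ k x ^ (n ^ k) t ^ (-k) = x`. -/
theorem pow_mul_zpow_pow_mul_inv {K : Type*} [Group K] {x t : K} {n : ℤ}
    (h : x * t = t * x ^ n) (k : ℕ) : t ^ k * x ^ (n ^ k) * (t ^ k)⁻¹ = x := by
  induction k with
  | zero => simp
  | succ k ih =>
    have h' : t * x ^ n * t⁻¹ = x := by rw [← h, mul_inv_cancel_right]
    calc t ^ (k + 1) * x ^ (n ^ (k + 1)) * (t ^ (k + 1))⁻¹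
        = t ^ k * (t * (x ^ n) ^ (n ^ k) * t⁻¹) * (t ^ k)⁻¹ := by
          rw [← zpow_mul, ← pow_succ' n, pow_succ t]; group
      _ = x := by rw [← conj_zpow, h', ih]

/-- An induction move induces an isomorphism of universal groups: if `e` is a
loop at `v` with `ψ(ē) = 1`, `ψ(e) = n`, `ℓ ∣ n^k`, and `ψ'` agrees with `ψ`
except that `ψ'(d) = ℓ·ψ(d)` for every edge `d ∉ {e, ē}` with `τ(d) = v`, then
the map fixing all generators other than `v` and sending `v ↦ v^ℓ` extends to an
isomorphism `F(Γ, ψ) → F(Γ, ψ')`, whose inverse fixes all generators other than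
`v` and sends `v ↦ e^k·v^{n^k/ℓ}·e^{−k}`. -/
theorem stmt_8 {V E : Type} [Finite V] [Finite E]
    (G : GBSGraph V E) (v : V) (e : E)
    (hιe : G.ini e = v) (hτe : G.ter e = v)
    (hbar1 : G.label (G.bar e) = 1)
    (n : ℤ) (hn : G.label e = n)
    (ℓ : ℤ) (hℓ : ℓ ≠ 0) (k : ℕ) (hdvd : ℓ ∣ n ^ k)
    (G' : GBSGraph V E)
    (hbar : G'.bar = G.bar) (hini : G'.ini = G.ini)
    (hlab1 : ∀ d, d ≠ e → d ≠ G.bar e → G.ter d = v → G'.label d = ℓ * G.label d)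
    (hlab2 : ∀ d, d = e ∨ d = G.bar e ∨ G.ter d ≠ v → G'.label d = G.label d) :
    ∃ φ : PresentedGroup G.rels ≃* PresentedGroup G'.rels,
      (∀ u : V, u ≠ v →
        φ (PresentedGroup.of (Sum.inl u)) = PresentedGroup.of (Sum.inl u)) ∧
      (∀ f : E, φ (PresentedGroup.of (Sum.inr f)) = PresentedGroup.of (Sum.inr f)) ∧
      φ (PresentedGroup.of (Sum.inl v)) = PresentedGroup.of (Sum.inl v) ^ ℓ ∧
      (∀ u : V, u ≠ v →
        φ.symm (PresentedGroup.of (Sum.inl u)) = PresentedGroup.of (Sum.inl u)) ∧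
      (∀ f : E, φ.symm (PresentedGroup.of (Sum.inr f)) = PresentedGroup.of (Sum.inr f)) ∧
      φ.symm (PresentedGroup.of (Sum.inl v)) =
        PresentedGroup.of (Sum.inr e) ^ k * PresentedGroup.of (Sum.inl v) ^ (n ^ k / ℓ) *
          (PresentedGroup.of (Sum.inr e) ^ k)⁻¹ := by
  classical
  have hterm (d : E) : G'.ter d = G.ter d := by simp [GBSGraph.ter, hbar, hini]
  obtain ⟨m, hm⟩ := hdvd
  have hdiv : n ^ k / ℓ = m := by rw [hm, Int.mul_ediv_cancel_left _ hℓ]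
  have hlab (d : E) (h1 : d ≠ e) (h2 : d ≠ G.bar e) :
      G'.label d = if G.ter d = v then ℓ * G.label d else G.label d := by
    split_ifs with h
    · exact hlab1 d h1 h2 h
    · exact hlab2 d (Or.inr (Or.inr h))
  have hle : G'.label e = n := (hlab2 e (Or.inl rfl)).trans hn
  have hlb : G'.label (G.bar e) = 1 := (hlab2 _ (Or.inr (Or.inl rfl))).trans hbar1
  have hG := G.of_ini_zpow_mul e
  rw [hιe, hτe, hbar1, hn, zpow_one] at hG
  have hG' := G'.of_ini_zpow_mul e
  rw [hterm, hini, hbar, hιe, hτe, hlb, hle, zpow_one] at hG'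
  have hroot : (PresentedGroup.of (Sum.inr e) ^ k * PresentedGroup.of (Sum.inl v) ^ m *
      (PresentedGroup.of (Sum.inr e) ^ k)⁻¹ : PresentedGroup G.rels) ^ ℓ =
      PresentedGroup.of (Sum.inl v) := by
    rw [conj_zpow, ← zpow_mul, mul_comm m, ← hm, pow_mul_zpow_pow_mul_inv hG]
  obtain ⟨φ, hφV, hφE⟩ := G.exists_hom_of_zpow_eq G' hbar hini e
    (fun u => if u = v then PresentedGroup.of (Sum.inl v) ^ ℓ else PresentedGroup.of (Sum.inl u))
    (by
      intro d h1 h2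
      rw [hlab d h1 h2]
      by_cases h : G.ter d = v
      · simp [h, zpow_mul]
      · simp [h])
    (by
      have h := (show SemiconjBy _ _ _ from hG'.symm).zpow_right ℓ
      simpa [hιe, hτe, hbar1, hn, ← zpow_mul, mul_comm] using h.eq.symm)
  obtain ⟨χ, hχV, hχE⟩ := G'.exists_hom_of_zpow_eq G hbar.symm hini.symm e
    (fun u => if u = v then PresentedGroup.of (Sum.inr e) ^ k * PresentedGroup.of (Sum.inl v) ^ m *
      (PresentedGroup.of (Sum.inr e) ^ k)⁻¹ else PresentedGroup.of (Sum.inl u))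
    (by
      intro d h1 h2
      rw [hbar] at h2
      rw [hlab d h1 h2, hterm]
      by_cases h : G.ter d = v
      · simp only [h, if_true]
        rw [zpow_mul, hroot]
      · simp [h])
    (by
      simp only [hterm, hini, hbar, hιe, hτe, hlb, hle, zpow_one, if_true]
      generalize (PresentedGroup.of (Sum.inl v) : PresentedGroup G.rels) = x at hG
      generalize (PresentedGroup.of (Sum.inr e) : PresentedGroup G.rels) = t at hG
      have h : SemiconjBy t (x ^ n) x := hG.symm
      have hx : x ^ m * t = t * (x ^ m) ^ n := by
        rw [← zpow_mul, mul_comm m, zpow_mul]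
        exact (h.zpow_right m).eq.symm
      rw [conj_zpow]
      calc t ^ k * x ^ m * (t ^ k)⁻¹ * t = t ^ k * (x ^ m * t) * (t ^ k)⁻¹ := by group
        _ = t * (t ^ k * (x ^ m) ^ n * (t ^ k)⁻¹) := by rw [hx]; group)
  have hχφ : χ.comp φ = MonoidHom.id _ := by
    refine PresentedGroup.ext ?_
    rintro (u | f)
    · by_cases h : u = v
      · simp only [MonoidHom.comp_apply, hφV, h, if_true, map_zpow, hχV, hroot, MonoidHom.id_apply]
      · simp [hφV, hχV, h]
    · simp [hφE, hχE]
  have hφχ : φ.comp χ = MonoidHom.id _ := by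
    refine PresentedGroup.ext ?_
    rintro (u | f)
    · by_cases h : u = v
      · simp only [MonoidHom.comp_apply, hφV, h, if_true, map_zpow, hχV, MonoidHom.id_apply,
          map_mul, map_inv, map_pow, hφE]
        rw [← zpow_mul, ← hm, pow_mul_zpow_pow_mul_inv hG']
      · simp [hφV, hχV, h]
    · simp [hφE, hχE]
  refine ⟨φ.toMulEquiv χ hχφ hφχ, fun u hu => ?_, hφE, ?_, fun u hu => ?_, hχE, ?_⟩
  · exact (hφV u).trans (if_neg hu)
  · exact (hφV v).trans (if_pos rfl)
  · exact (hχV u).trans (if_neg hu)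
  · rw [hdiv]
    exact (hχV v).trans (if_pos rfl)
end

section
/- Let (Γ, ψ) be a GBS graph and let v ∈ V. If v admits a set of collapsing data, then v is redundant. -/
/-- `vec z ∈ A⁺` for `z ∈ ℤ∖{0}`: the `ℤ/2ℤ` component records the sign of `z`,
and the `i`-th coordinate (`i : ℕ`, corresponding to the `(i+1)`-st prime) is the
exponent of the `(i+1)`-st prime `Nat.nth Nat.Prime i` in the factorization of `|z|`. -/
noncomputable def vec (z : ℤ) : A :=
  (if 0 < z then 0 else 1,
    Finsupp.comapDomain (Nat.nth Nat.Prime)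
      (z.natAbs.factorization.mapRange (fun n : ℕ => (n : ℤ)) (by simp))
      ((Nat.nth_injective Nat.infinite_setOf_prime).injOn))

namespace GBSGraph

variable {V E : Type}

/-- Initial endpoint of an edge in the affine representation: `(ι(e), vec(ψ(ē)))`. -/
noncomputable def affI (G : GBSGraph V E) (e : E) : V × A :=
  (G.ini e, vec (G.label (G.bar e)))

/-- Terminal endpoint of an edge in the affine representation: `(τ(e), vec(ψ(e)))`. -/
noncomputable def affT (G : GBSGraph V E) (e : E) : V × A :=
  (G.ter e, vec (G.label e))

/-- One step of an affine path: there is an edge `e` and a translation `w ∈ A⁺`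
with `ιΛ(e) + w = p` and `τΛ(e) + w = q`. -/
def AffStep (G : GBSGraph V E) (p q : V × A) : Prop :=
  ∃ (e : E) (w : A), Apos w ∧
    ((G.affI e).1, (G.affI e).2 + w) = p ∧ ((G.affT e).1, (G.affT e).2 + w) = q

/-- Conjugacy of points of the affine representation: reachability by affine paths. -/
def Conj (G : GBSGraph V E) : V × A → V × A → Prop :=
  Relation.ReflTransGen (AffStep G)

/-- A vertex `v` is redundant if `(v, 0)` is conjugate to a point `(u, b)` with
`u ≠ v`. -/
def Redundant (G : GBSGraph V E) (v : V) : Prop :=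
  ∃ (u : V) (b : A), u ≠ v ∧ Apos b ∧ G.Conj (v, 0) (u, b)

/-- A set of collapsing data for a vertex `v`: pairwise distinct edges
`es 0, …, es (n−1), e` such that each `es j` goes from `(v, a_j)` to `(v, b_j)`
with `supp(a_j) ⊆ supp(b_0) ∪ … ∪ supp(b_{j−1})`, and `e` goes from `(v, c)` to
`(u, d)` with `u ≠ v` and `supp(c) ⊆ supp(b_0) ∪ … ∪ supp(b_{n−1})`. -/
def CollapsingData (G : GBSGraph V E) (v : V) (n : ℕ) (es : Fin n → E) (e : E) : Prop :=
  Function.Injective es ∧ (∀ i, es i ≠ e) ∧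
  (∀ i, G.ini (es i) = v ∧ G.ter (es i) = v) ∧
  (∀ j : Fin n, suppA (vec (G.label (G.bar (es j)))) ⊆
    (Finset.univ.filter fun i : Fin n => i < j).biUnion
      fun i => suppA (vec (G.label (es i)))) ∧
  G.ini e = v ∧ G.ter e ≠ v ∧
  suppA (vec (G.label (G.bar e))) ⊆
    Finset.univ.biUnion fun i : Fin n => suppA (vec (G.label (es i)))

end GBSGraph

theorem apos_vec (z : ℤ) : Apos (vec z) := by
  intro i
  simp [vec]

theorem exists_nat_bound (a : A) : ∃ C : ℕ, ∀ i, a.2 i ≤ C := by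
  refine ⟨a.2.support.sup fun i => (a.2 i).toNat, fun i => ?_⟩
  by_cases hi : i ∈ a.2.support
  · have := Finset.le_sup (f := fun i => (a.2 i).toNat) hi
    omega
  · rw [Finsupp.notMem_support_iff.mp hi]
    positivity

namespace GBSGraph

variable {V E : Type}

theorem affStep_of_le (G : GBSGraph V E) (e : E) (x : A)
    (hx : ∀ i, (vec (G.label (G.bar e))).2 i ≤ x.2 i) :
    G.AffStep (G.ini e, x) (G.ter e, x - vec (G.label (G.bar e)) + vec (G.label e)) := by
  refine ⟨e, x - vec (G.label (G.bar e)), fun i => ?_, ?_, ?_⟩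
  · simpa using hx i
  · simp [affI]
  · simp [affT, add_comm]

theorem conj_iterate_loop (G : GBSGraph V E) {v : V} {e : E} (hi : G.ini e = v)
    (ht : G.ter e = v) (M : ℕ) (x : A)
    (hx : ∀ i, M * (vec (G.label (G.bar e))).2 i ≤ x.2 i) :
    G.Conj (v, x) (v, x + M • (vec (G.label e) - vec (G.label (G.bar e)))) := by
  induction M generalizing x with
  | zero => simp [Conj, Relation.ReflTransGen.refl]
  | succ M ih =>
    have ha := apos_vec (G.label (G.bar e))
    have hb := apos_vec (G.label e)
    have hle (i : ℕ) : M * (vec (G.label (G.bar e))).2 i + (vec (G.label (G.bar e))).2 i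
        ≤ x.2 i := by
      have := hx i
      push_cast at this
      linarith
    have hM (i : ℕ) : 0 ≤ M * (vec (G.label (G.bar e))).2 i :=
      mul_nonneg (Nat.cast_nonneg M) (ha i)
    have hstep := G.affStep_of_le e x fun i => by linarith [hle i, hM i]
    rw [hi, ht] at hstep
    have htail := ih (x - vec (G.label (G.bar e)) + vec (G.label e))
      (fun i => by
        simp only [Prod.snd_add, Prod.snd_sub, Finsupp.add_apply, Finsupp.sub_apply]
        linarith [hle i, hb i])
    have heq : x + (M + 1) • (vec (G.label e) - vec (G.label (G.bar e))) =
        x - vec (G.label (G.bar e)) + vec (G.label e) +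
          M • (vec (G.label e) - vec (G.label (G.bar e))) := by
      rw [succ_nsmul']
      abel
    rw [heq]
    exact Relation.ReflTransGen.head hstep htail

/-- From `(v, 0)` one can reach points of `v` whose coordinates in `S` are arbitrarily large. -/
def Pumpable (G : GBSGraph V E) (v : V) (S : Finset ℕ) : Prop :=
  ∀ N : ℕ, ∃ x : A, Apos x ∧ G.Conj (v, 0) (v, x) ∧ ∀ i ∈ S, (N : ℤ) ≤ x.2 i

theorem Pumpable.exists_mul_le {G : GBSGraph V E} {v : V} {S : Finset ℕ}
    (h : G.Pumpable v S) {a : A} (hS : suppA a ⊆ S) (N : ℕ) :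
    ∃ x : A, Apos x ∧ G.Conj (v, 0) (v, x) ∧ (∀ i ∈ S, N + N * a.2 i ≤ x.2 i) ∧
      ∀ i, N * a.2 i ≤ x.2 i := by
  obtain ⟨C, hC⟩ := exists_nat_bound a
  obtain ⟨x, hx, hconj, hN⟩ := h (N + N * C)
  have hlarge : ∀ i ∈ S, N + N * a.2 i ≤ x.2 i := fun i hi => by
    have h₁ := hN i hi
    have h₂ := mul_le_mul_of_nonneg_left (hC i) (Nat.cast_nonneg (α := ℤ) N)
    push_cast at h₁
    linarith
  refine ⟨x, hx, hconj, hlarge, fun i => ?_⟩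
  by_cases hi : i ∈ S
  · linarith [hlarge i hi, Nat.cast_nonneg (α := ℤ) N]
  · rw [Finsupp.notMem_support_iff.mp fun h' => hi (hS h'), mul_zero]
    exact hx i

theorem Pumpable.union_loop {G : GBSGraph V E} {v : V} {S : Finset ℕ}
    (h : G.Pumpable v S) {e : E} (hi : G.ini e = v) (ht : G.ter e = v)
    (hS : suppA (vec (G.label (G.bar e))) ⊆ S) :
    G.Pumpable v (S ∪ suppA (vec (G.label e))) := by
  intro N
  obtain ⟨x, hx, hconj, hlarge, hle⟩ := h.exists_mul_le hS N
  have hb (i : ℕ) : 0 ≤ N * (vec (G.label e)).2 i :=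
    mul_nonneg (Nat.cast_nonneg N) (apos_vec _ i)
  have hval (i : ℕ) : (x + N • (vec (G.label e) - vec (G.label (G.bar e)))).2 i =
      x.2 i + N * (vec (G.label e)).2 i - N * (vec (G.label (G.bar e))).2 i := by
    simp
    ring
  refine ⟨_, fun i => ?_, hconj.trans (G.conj_iterate_loop hi ht N x hle), fun i hmem => ?_⟩
  · rw [hval]
    linarith [hle i, hb i]
  · rw [hval]
    by_cases hiS : i ∈ S
    · linarith [hlarge i hiS, hb i]
    · have hzero : (vec (G.label (G.bar e))).2 i = 0 :=
        Finsupp.notMem_support_iff.mp fun h' => hiS (hS h')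
      have hne : (vec (G.label e)).2 i ≠ 0 :=
        Finsupp.mem_support_iff.mp ((Finset.mem_union.mp hmem).resolve_left hiS)
      have hone : 1 ≤ (vec (G.label e)).2 i := by
        have := apos_vec (G.label e) i
        omega
      rw [hzero]
      nlinarith [hx i, mul_le_mul_of_nonneg_left hone (Nat.cast_nonneg (α := ℤ) N)]

theorem CollapsingData.pumpable {G : GBSGraph V E} {v : V} {n : ℕ} {es : Fin n → E} {e : E}
    (h : G.CollapsingData v n es e) {k : ℕ} (hk : k ≤ n) :
    G.Pumpable v ((Finset.univ.filter fun i : Fin n => (i : ℕ) < k).biUnion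
      fun i => suppA (vec (G.label (es i)))) := by
  obtain ⟨-, -, hloop, hsupp, -⟩ := h
  induction k with
  | zero =>
    exact fun N => ⟨0, fun i => by simp, Relation.ReflTransGen.refl, by simp⟩
  | succ k ih =>
    let j : Fin n := ⟨k, hk⟩
    have key := (ih (by omega)).union_loop (hloop j).1 (hloop j).2 (hsupp j)
    have hfilter : (Finset.univ.filter fun i : Fin n => (i : ℕ) < k + 1) =
        insert j (Finset.univ.filter fun i : Fin n => (i : ℕ) < k) := by
      ext i
      simp [j, Fin.ext_iff]
      omega
    rwa [hfilter, Finset.biUnion_insert, Finset.union_comm]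

end GBSGraph

/-- If a vertex of a GBS graph admits a set of collapsing data, then it is redundant. -/
theorem stmt_13 {V E : Type} [Finite V] [Finite E]
    (G : GBSGraph V E) (v : V)
    (h : ∃ (n : ℕ) (es : Fin n → E) (e : E), G.CollapsingData v n es e) :
    G.Redundant v := by
  obtain ⟨n, es, e, h⟩ := h
  have hpump := h.pumpable le_rfl
  obtain ⟨-, -, -, -, hini, hter, hsupp⟩ := h
  simp only [Fin.is_lt, Finset.filter_true] at hpump
  obtain ⟨x, -, hconj, -, hle⟩ := hpump.exists_mul_le hsupp 1
  simp only [Nat.cast_one, one_mul] at hle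
  have hstep := G.affStep_of_le e x hle
  rw [hini] at hstep
  refine ⟨_, _, hter, fun i => ?_, hconj.tail hstep⟩
  simp only [Prod.snd_add, Prod.snd_sub, Finsupp.add_apply, Finsupp.sub_apply]
  linarith [hle i, apos_vec (G.label e) i]
end
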